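/- Let D, d, d_e be positive integers with d_e ≤ d ≤ D, and set n = d − d_e + 1. Let U ∈ ℝ^{D×d_e} have orthonormal columns, let z* ∈ ℝ^{d_e} be nonzero, and set x_T* = U z*. For a D×d matrix A define y₂*(A) = Bᵀ (B Bᵀ)⁻¹ z* where B = Uᵀ A (defined for the almost-every A for which B Bᵀ is invertible, with an arbitrary value otherwise). Then the pushforward of the Gaussian matrix measure under A ↦ y₂*(A) is absolutely continuous with respect to Lebesgue measure on ℝ^d with density g*(y) = π^{−d/2} · (Γ(d/2)/Γ(n/2)) · (‖x_T*‖₂/√2)^n · (yᵀy)^{−(n+d)/2} · exp(−‖x_T*‖₂²/(2 yᵀy)) for y ≠ 0. -/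

import Mathlib

open MeasureTheory ProbabilityTheory Matrix

noncomputable def gaussMatrix (D d : ℕ) : Measure (Fin D → Fin d → ℝ) :=
  Measure.pi fun _ : Fin D => Measure.pi fun _ : Fin d => gaussianReal 0 1

noncomputable def chiSq (n : ℕ) : Measure ℝ := gammaMeasure (n / 2) (1 / 2)

open scoped RealInnerProductSpace

section Density

variable {E : Type*} [NormedAddCommGroup E] [InnerProductSpace ℝ E]

/-- The density of the standard Gaussian measure, as a function of the norm. -/
noncomputable def stdGaussianPDF (E : Type*) [NormedAddCommGroup E] [InnerProductSpace ℝ E]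
    (r : ℝ) : ℝ :=
  (2 * Real.pi) ^ (-(Module.finrank ℝ E : ℝ) / 2) * Real.exp (-(r ^ 2) / 2)

lemma stdGaussianPDF_nonneg (r : ℝ) : 0 ≤ stdGaussianPDF E r := by
  unfold stdGaussianPDF; positivity

@[fun_prop]
lemma continuous_stdGaussianPDF : Continuous (stdGaussianPDF E) := by
  unfold stdGaussianPDF; fun_prop

variable [FiniteDimensional ℝ E] [MeasurableSpace E] [BorelSpace E]

lemma integrable_stdGaussianPDF : Integrable fun x : E => stdGaussianPDF E ‖x‖ := by
  unfold stdGaussianPDF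
  apply Integrable.const_mul
  have := (GaussianFourier.integrable_cexp_neg_mul_sq_norm_add (b := 1 / 2) (by norm_num) 0
    (0 : E)).norm
  refine this.congr (Filter.Eventually.of_forall fun x => ?_)
  simp only [Complex.norm_exp]
  congr 1
  have : (-(1 / 2) * (‖x‖ : ℂ) ^ 2 + 0 * (⟪(0 : E), x⟫ : ℂ)) = ((-(‖x‖ ^ 2) / 2 : ℝ) : ℂ) := by
    push_cast; ring
  rw [this, Complex.ofReal_re]

lemma stdGaussian_eq_withDensity :
    stdGaussian E = volume.withDensity fun x => ENNReal.ofReal (stdGaussianPDF E ‖x‖) := by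
  have := isFiniteMeasure_withDensity_ofReal (integrable_stdGaussianPDF (E := E)).2
  apply Measure.ext_of_charFun
  ext t
  rw [charFun_stdGaussian, charFun_apply, integral_withDensity_eq_integral_toReal_smul
    (by fun_prop) (by simp)]
  simp_rw [ENNReal.toReal_ofReal (stdGaussianPDF_nonneg _), stdGaussianPDF]
  have h (x : E) : ((2 * Real.pi) ^ (-(Module.finrank ℝ E : ℝ) / 2)
        * Real.exp (-(‖x‖ ^ 2) / 2) : ℝ) • Complex.exp (⟪x, t⟫ * Complex.I)
      = (((2 * Real.pi) ^ (-(Module.finrank ℝ E : ℝ) / 2) : ℝ) : ℂ)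
        * Complex.exp (-(1 / 2 : ℂ) * ‖x‖ ^ 2 + Complex.I * ⟪t, x⟫) := by
    rw [Complex.real_smul, Complex.exp_add, real_inner_comm, mul_comm Complex.I]
    push_cast
    rw [mul_assoc]
    congr 3
    ring_nf
  simp_rw [h]
  rw [integral_const_mul, GaussianFourier.integral_cexp_neg_mul_sq_norm_add (by norm_num)]
  rw [Complex.ofReal_cpow (by positivity), ← mul_assoc]
  have h2 : (Real.pi / (1 / 2) : ℂ) = ((2 * Real.pi : ℝ) : ℂ) := by push_cast; ring
  rw [h2]
  push_cast
  rw [← Complex.cpow_add _ _ (by simp)]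
  ring_nf
  simp
  ring_nf

lemma stdGaussian_absolutelyContinuous : stdGaussian E ≪ volume := by
  rw [stdGaussian_eq_withDensity]
  exact withDensity_absolutelyContinuous _ _

lemma finrank_mul_measureReal_unitBall [Nontrivial E] :
    (Module.finrank ℝ E : ℝ) * volume.real (Metric.ball (0 : E) 1)
      = 2 * Real.pi ^ ((Module.finrank ℝ E : ℝ) / 2) / Real.Gamma (Module.finrank ℝ E / 2) := by
  have hn : (0 : ℝ) < Module.finrank ℝ E := by exact_mod_cast Module.finrank_pos
  have hΓ : 0 < Real.Gamma ((Module.finrank ℝ E : ℝ) / 2) := Real.Gamma_pos_of_pos (by positivity)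
  rw [Measure.real, InnerProductSpace.volume_ball, Real.Gamma_add_one (by positivity)]
  simp only [ENNReal.ofReal_one, one_pow, one_mul]
  rw [ENNReal.toReal_ofReal (by positivity), Real.sqrt_eq_rpow, ← Real.rpow_mul_natCast
    Real.pi_pos.le]
  field_simp

lemma integral_fun_norm_volume [Nontrivial E] (h : ℝ → ℝ) :
    ∫ x : E, h ‖x‖ = 2 * Real.pi ^ ((Module.finrank ℝ E : ℝ) / 2)
        / Real.Gamma (Module.finrank ℝ E / 2) *
      ∫ r in Set.Ioi (0 : ℝ), r ^ (Module.finrank ℝ E - 1) * h r := by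
  rw [integral_fun_norm_addHaar, ← finrank_mul_measureReal_unitBall]
  simp [mul_assoc]

lemma integral_norm_stdGaussian (h : ℝ → ℝ) :
    ∫ x, h ‖x‖ ∂stdGaussian E = ∫ x : E, stdGaussianPDF E ‖x‖ * h ‖x‖ := by
  rw [stdGaussian_eq_withDensity, integral_withDensity_eq_integral_toReal_smul
    (by fun_prop) (by simp)]
  simp [ENNReal.toReal_ofReal (stdGaussianPDF_nonneg _)]

/-- The density, as a function of the norm, of the rotation invariant random vector in dimension
`d` whose norm is `c` divided by the norm of a standard Gaussian vector in dimension `n`. -/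
noncomputable def inverseChiPDF (n d : ℕ) (c r : ℝ) : ℝ :=
  Real.pi ^ (-(d : ℝ) / 2) *
    (Real.Gamma ((d : ℝ) / 2) / Real.Gamma ((n : ℝ) / 2)) *
    (Real.sqrt (c ^ 2) / Real.sqrt 2) ^ n *
    (r ^ 2) ^ (-(((n : ℝ) + (d : ℝ)) / 2)) *
    Real.exp (-(c ^ 2) / (2 * r ^ 2))

lemma inverseChiPDF_nonneg {n d : ℕ} (hn : 0 < n) (hd : 0 < d) (c r : ℝ) :
    0 ≤ inverseChiPDF n d c r := by
  unfold inverseChiPDF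
  have h1 : 0 < Real.Gamma ((d : ℝ) / 2) := Real.Gamma_pos_of_pos (by positivity)
  have h2 : 0 < Real.Gamma ((n : ℝ) / 2) := Real.Gamma_pos_of_pos (by positivity)
  positivity

@[fun_prop]
lemma measurable_inverseChiPDF (n d : ℕ) (c : ℝ) : Measurable (inverseChiPDF n d c) := by
  unfold inverseChiPDF
  fun_prop

lemma setIntegral_Ioi_comp_div (g : ℝ → ℝ) {c : ℝ} (hc : 0 < c) :
    ∫ r in Set.Ioi (0 : ℝ), g r = ∫ r in Set.Ioi (0 : ℝ), c / r ^ 2 * g (c / r) := by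
  have h1 := integral_comp_mul_left_Ioi' g 0 hc
  rw [mul_zero] at h1
  rw [← h1, ← integral_comp_rpow_Ioi _ (p := -1) (by norm_num), ← integral_smul]
  refine setIntegral_congr_fun measurableSet_Ioi fun r hr => ?_
  have hr : 0 < r := hr
  have : r ^ (-1 - 1 : ℝ) = (r ^ 2)⁻¹ := by
    rw [← Real.rpow_natCast, ← Real.rpow_neg hr.le]; norm_num
  simp only [smul_eq_mul, this, Real.rpow_neg_one]
  simp [div_eq_mul_inv, mul_assoc]

lemma inverseChiPDF_div {n d : ℕ} (hn : 0 < n) (hd : 0 < d) {c r : ℝ} (hc : 0 < c) (hr : 0 < r) :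
    2 * Real.pi ^ ((d : ℝ) / 2) / Real.Gamma (d / 2) *
        (c / r ^ 2 * ((c / r) ^ (d - 1) * inverseChiPDF n d c (c / r)))
      = 2 * Real.pi ^ ((n : ℝ) / 2) / Real.Gamma (n / 2) *
        (r ^ (n - 1) * ((2 * Real.pi) ^ (-(n : ℝ) / 2) * Real.exp (-(r ^ 2) / 2))) := by
  have h1 : 0 < Real.Gamma ((d : ℝ) / 2) := Real.Gamma_pos_of_pos (by positivity)
  have h2 : 0 < Real.Gamma ((n : ℝ) / 2) := Real.Gamma_pos_of_pos (by positivity)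
  have hpi := Real.pi_pos
  have e1 : Real.exp (-(c ^ 2) / (2 * (c / r) ^ 2)) = Real.exp (-(r ^ 2) / 2) := by
    congr 1; field_simp
  have e2 : ((c / r) ^ 2) ^ (-(((n : ℝ) + (d : ℝ)) / 2)) = ((c / r) ^ (n + d))⁻¹ := by
    rw [← Real.rpow_natCast, ← Real.rpow_mul (by positivity), ← Real.rpow_natCast,
      ← Real.rpow_neg (by positivity)]
    congr 1; push_cast; ring
  have e3 : (2 * Real.pi) ^ (-(n : ℝ) / 2) = (Real.sqrt 2 ^ n)⁻¹ * (Real.pi ^ ((n : ℝ) / 2))⁻¹ := by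
    rw [Real.mul_rpow (by norm_num) hpi.le, neg_div, Real.rpow_neg (by norm_num),
      Real.rpow_neg hpi.le, Real.sqrt_eq_rpow, ← Real.rpow_mul_natCast (by norm_num)]
    congr 3; ring
  have e4 : Real.pi ^ (-(d : ℝ) / 2) = (Real.pi ^ ((d : ℝ) / 2))⁻¹ := by
    rw [neg_div, Real.rpow_neg hpi.le]
  unfold inverseChiPDF
  rw [e1, e2, e3, e4, Real.sqrt_sq hc.le]
  obtain ⟨n, rfl⟩ := Nat.exists_eq_add_one.2 hn
  obtain ⟨d, rfl⟩ := Nat.exists_eq_add_one.2 hd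
  have h3 : 0 < Real.sqrt 2 := by positivity
  have h4 : 0 < Real.pi ^ (((n + 1 : ℕ) : ℝ) / 2) := by positivity
  have h5 : 0 < Real.pi ^ (((d + 1 : ℕ) : ℝ) / 2) := by positivity
  generalize Real.pi ^ (((n + 1 : ℕ) : ℝ) / 2) = A at *
  generalize Real.pi ^ (((d + 1 : ℕ) : ℝ) / 2) = B at *
  generalize Real.Gamma (((n + 1 : ℕ) : ℝ) / 2) = C at *
  generalize Real.Gamma (((d + 1 : ℕ) : ℝ) / 2) = D at *
  generalize Real.exp (-(r ^ 2) / 2) = X at *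
  simp only [Nat.add_sub_cancel, div_pow, pow_succ, pow_add]
  field_simp

/-- Comparison of radial integrals in two inner product spaces of different dimensions. -/
lemma integral_inverseChiPDF {S : Type*} [NormedAddCommGroup S] [InnerProductSpace ℝ S]
    [FiniteDimensional ℝ S] [MeasurableSpace S] [BorelSpace S] [Nontrivial E] [Nontrivial S]
    {c : ℝ} (hc : 0 < c) (h : ℝ → ℝ) :
    ∫ x : E, inverseChiPDF (Module.finrank ℝ S) (Module.finrank ℝ E) c ‖x‖ * h ‖x‖
      = ∫ x, h (c / ‖x‖) ∂stdGaussian S := by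
  rw [integral_norm_stdGaussian (E := S) fun r => h (c / r),
    integral_fun_norm_volume (E := S) fun r => stdGaussianPDF S r * h (c / r),
    integral_fun_norm_volume (E := E) fun r => inverseChiPDF _ _ c r * h r,
    setIntegral_Ioi_comp_div _ hc, ← integral_const_mul, ← integral_const_mul]
  refine setIntegral_congr_fun measurableSet_Ioi fun r hr => ?_
  have := inverseChiPDF_div (n := Module.finrank ℝ S) (d := Module.finrank ℝ E)
    Module.finrank_pos Module.finrank_pos hc hr
  have := congrArg (· * h (c / r)) this
  simp only [stdGaussianPDF] at this ⊢
  linear_combination this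

end Density

section Rotation

variable {E : Type*} [NormedAddCommGroup E] [InnerProductSpace ℝ E]

lemma exists_linearIsometryEquiv_apply_eq_of_norm_eq {x y : E} (h : ‖x‖ = ‖y‖) :
    ∃ f : E ≃ₗᵢ[ℝ] E, f x = y :=
  ⟨_, Submodule.reflection_sub h⟩

variable [MeasurableSpace E] [BorelSpace E]

lemma charFun_apply_eq_of_norm_eq {μ : Measure E}
    (hμ : ∀ f : E ≃ₗᵢ[ℝ] E, μ.map f = μ) {s t : E} (h : ‖s‖ = ‖t‖) :
    charFun μ s = charFun μ t := by
  obtain ⟨f, rfl⟩ := exists_linearIsometryEquiv_apply_eq_of_norm_eq h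
  nth_rewrite 2 [← hμ f]
  rw [charFun_apply, charFun_apply, integral_map (by fun_prop) (by fun_prop)]
  simp [f.inner_map_map]

variable [FiniteDimensional ℝ E]

/-- The distribution of the direction of a standard Gaussian vector. -/
noncomputable def gaussianDirection (E : Type*) [NormedAddCommGroup E] [InnerProductSpace ℝ E]
    [FiniteDimensional ℝ E] [MeasurableSpace E] : Measure E :=
  (stdGaussian E).map fun x => ‖x‖⁻¹ • x

lemma measurable_norm_inv_smul : Measurable fun x : E => ‖x‖⁻¹ • x := by
  fun_prop

instance : IsProbabilityMeasure (gaussianDirection E) :=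
  Measure.isProbabilityMeasure_map measurable_norm_inv_smul.aemeasurable

lemma map_linearIsometryEquiv_gaussianDirection (f : E ≃ₗᵢ[ℝ] E) :
    (gaussianDirection E).map f = gaussianDirection E := by
  rw [gaussianDirection, Measure.map_map (by fun_prop) (by fun_prop)]
  conv_rhs => rw [← stdGaussian_map f,
    Measure.map_map (by fun_prop) (by fun_prop)]
  congr 1
  ext x
  simp

lemma ae_ne_zero_stdGaussian [Nontrivial E] :
    ∀ᵐ x ∂stdGaussian E, x ≠ 0 :=
  stdGaussian_absolutelyContinuous.ae_le (compl_mem_ae_iff.2 (measure_singleton 0))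

lemma ae_norm_gaussianDirection [Nontrivial E] :
    ∀ᵐ u ∂gaussianDirection E, ‖u‖ = 1 := by
  rw [gaussianDirection, ae_map_iff measurable_norm_inv_smul.aemeasurable
    (measurableSet_eq_fun (by fun_prop) (by fun_prop))]
  filter_upwards [ae_ne_zero_stdGaussian] with x hx
  simp [norm_smul, hx]

/-- The characteristic function of a rotation invariant measure only depends on the law of the
norm: averaging over a random direction of the argument and exchanging the integrals moves the
rotation onto the variable. -/
lemma charFun_eq_integral_charFun_gaussianDirection [Nontrivial E] {μ : Measure E}
    [IsFiniteMeasure μ] (hμ : ∀ f : E ≃ₗᵢ[ℝ] E, μ.map f = μ) (t : E) :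
    charFun μ t = ∫ x, charFun (gaussianDirection E) (‖t‖ • x) ∂μ := by
  have h1 : ∀ᵐ u ∂gaussianDirection E, charFun μ (‖t‖ • u) = charFun μ t := by
    filter_upwards [ae_norm_gaussianDirection] with u hu
    exact charFun_apply_eq_of_norm_eq hμ (by simp [norm_smul, hu])
  calc charFun μ t = ∫ u, charFun μ (‖t‖ • u) ∂gaussianDirection E := by
        rw [integral_congr_ae h1]; simp
    _ = ∫ u, ∫ x, Complex.exp (⟪x, ‖t‖ • u⟫ * Complex.I) ∂μ ∂gaussianDirection E := by
        rfl
    _ = ∫ x, ∫ u, Complex.exp (⟪x, ‖t‖ • u⟫ * Complex.I) ∂gaussianDirection E ∂μ := by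
        apply integral_integral_swap
        apply Integrable.of_bound (C := 1) (Measurable.aestronglyMeasurable (by fun_prop))
        filter_upwards with p
        exact (Complex.norm_exp_ofReal_mul_I _).le
    _ = _ := by
        congr with x
        rw [charFun_apply]
        congr with u
        rw [real_inner_smul_right, real_inner_smul_right, real_inner_comm]

lemma ext_of_map_norm_eq [Nontrivial E] {μ ν : Measure E} [IsFiniteMeasure μ] [IsFiniteMeasure ν]
    (hμ : ∀ f : E ≃ₗᵢ[ℝ] E, μ.map f = μ) (hν : ∀ f : E ≃ₗᵢ[ℝ] E, ν.map f = ν)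
    (h : μ.map (fun x => ‖x‖) = ν.map (fun x => ‖x‖)) : μ = ν := by
  obtain ⟨e, he⟩ := exists_norm_eq E zero_le_one
  apply Measure.ext_of_charFun
  ext t
  have key (x : E) : charFun (gaussianDirection E) (‖t‖ • x)
      = (fun r : ℝ => charFun (gaussianDirection E) ((‖t‖ * r) • e)) ‖x‖ :=
    charFun_apply_eq_of_norm_eq map_linearIsometryEquiv_gaussianDirection
      (by simp [norm_smul, he])
  have hmeas : Measurable fun r : ℝ => charFun (gaussianDirection E) ((‖t‖ * r) • e) := by
    fun_prop
  rw [charFun_eq_integral_charFun_gaussianDirection hμ,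
    charFun_eq_integral_charFun_gaussianDirection hν]
  simp_rw [key]
  rw [← integral_map (φ := fun x : E => ‖x‖) (by fun_prop) hmeas.aestronglyMeasurable,
    ← integral_map (φ := fun x : E => ‖x‖) (by fun_prop) hmeas.aestronglyMeasurable, h]

end Rotation

lemma map_withDensity_comp {α β : Type*} [MeasurableSpace α] [MeasurableSpace β]
    {μ : Measure α} {ν : Measure β} {e : α → β} (he : MeasurePreserving e μ ν)
    {f : β → ENNReal} (hf : Measurable f) :
    (μ.withDensity fun x => f (e x)).map e = ν.withDensity f := by
  ext s hs
  rw [Measure.map_apply he.measurable hs, withDensity_apply _ (he.measurable hs),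
    withDensity_apply _ hs, he.setLIntegral_comp_preimage hs hf]

section MinimalNormSolution

variable {E : Type*} [NormedAddCommGroup E] [InnerProductSpace ℝ E]

/-- The solution `y` of minimal norm of the equations `⟪b i, y⟫ = z i`. -/
noncomputable def minNormSol {m : ℕ} (z : Fin m → ℝ) (b : Fin m → E) : E :=
  ∑ i, ((gram ℝ b)⁻¹ *ᵥ z) i • b i

lemma inner_minNormSol {m : ℕ} (z : Fin m → ℝ) {b : Fin m → E} (hb : LinearIndependent ℝ b)
    (i : Fin m) : ⟪b i, minNormSol z b⟫ = z i := by
  have hdet : IsUnit (gram ℝ b).det :=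
    isUnit_iff_ne_zero.2 (det_gram_ne_zero_iff_linearIndependent.2 hb)
  have h : gram ℝ b *ᵥ ((gram ℝ b)⁻¹ *ᵥ z) = z := by
    rw [mulVec_mulVec, mul_nonsing_inv _ hdet, one_mulVec]
  conv_rhs => rw [← h]
  simp only [minNormSol, inner_sum, real_inner_smul_right, mulVec, dotProduct, gram_apply]
  exact Finset.sum_congr rfl fun j _ => mul_comm _ _

lemma minNormSol_map {m : ℕ} (z : Fin m → ℝ) (b : Fin m → E) (f : E ≃ₗᵢ[ℝ] E) :
    minNormSol z (fun i => f (b i)) = f (minNormSol z b) := by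
  have : gram ℝ (fun i => f (b i)) = gram ℝ b := by
    ext i j; simp [gram_apply]
  simp [minNormSol, this]

lemma continuous_gram {m : ℕ} : Continuous fun b : Fin m → E => gram ℝ b := by
  refine continuous_matrix fun i j => ?_
  simp only [gram_apply]
  fun_prop

lemma norm_minNormSol_single_cons [FiniteDimensional ℝ E] {m : ℕ} {c : ℝ} (hc : 0 < c) {g : E}
    {b : Fin m → E} (hb : LinearIndependent ℝ (Fin.cons g b : Fin (m + 1) → E)) :
    ‖minNormSol (Pi.single 0 c) (Fin.cons g b : Fin (m + 1) → E)‖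
      = c / ‖(Submodule.span ℝ (Set.range b))ᗮ.orthogonalProjectionOnto g‖ := by
  set y := minNormSol (Pi.single 0 c) (Fin.cons g b : Fin (m + 1) → E) with hy
  set S := (Submodule.span ℝ (Set.range b))ᗮ
  have h0 : ⟪g, y⟫ = c := by simpa using inner_minNormSol (Pi.single 0 c) hb 0
  have hS : y ∈ S := by
    rw [Submodule.mem_orthogonal]
    intro u hu
    induction hu using Submodule.span_induction with
    | mem x hx =>
      obtain ⟨i, rfl⟩ := hx
      simpa using inner_minNormSol (Pi.single 0 c) hb i.succ
    | zero => simp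
    | add x x' _ _ hx hx' => simp [inner_add_left, hx, hx']
    | smul a x _ hx => simp [inner_smul_left, hx]
  obtain ⟨w, hw⟩ : ∃ w : ℝ, y = w • (S.orthogonalProjectionOnto g : E) := by
    refine ⟨((gram ℝ (Fin.cons g b : Fin (m + 1) → E))⁻¹ *ᵥ Pi.single 0 c) 0, ?_⟩
    have hz (i : Fin m) : S.orthogonalProjectionOnto (b i) = 0 := by
      rw [Submodule.orthogonalProjectionOnto_eq_zero_iff]
      exact Submodule.le_orthogonal_orthogonal _ (Submodule.subset_span ⟨i, rfl⟩)
    have h1 : S.orthogonalProjectionOnto y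
        = ((gram ℝ (Fin.cons g b : Fin (m + 1) → E))⁻¹ *ᵥ Pi.single 0 c) 0
          • S.orthogonalProjectionOnto g := by
      rw [hy, minNormSol, map_sum]
      simp [Fin.sum_univ_succ, hz]
    rw [← Submodule.coe_smul, ← h1]
    exact (congrArg Subtype.val (Submodule.orthogonalProjectionOnto_mem_subspace_eq_self
      (K := S) ⟨y, hS⟩)).symm
  set p := S.orthogonalProjectionOnto g
  have h3 : w * ‖p‖ ^ 2 = c := by
    rw [← h0, hw, real_inner_smul_right, ← Submodule.inner_orthogonalProjectionOnto_eq_of_mem_right,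
      real_inner_self_eq_norm_sq]
  have hw0 : 0 < w := by
    by_contra h
    nlinarith [sq_nonneg ‖p‖]
  have hp : ‖p‖ ≠ 0 := by
    intro h; rw [h] at h3; simp at h3; exact hc.ne h3
  rw [hw, norm_smul, Real.norm_of_nonneg hw0.le, ← h3]
  simp only [Submodule.coe_norm]
  field_simp

end MinimalNormSolution

section GaussianFamily

variable {E : Type*} [NormedAddCommGroup E] [InnerProductSpace ℝ E] [FiniteDimensional ℝ E]
  [MeasurableSpace E] [BorelSpace E]

lemma measurable_minNormSol {m : ℕ} (z : Fin m → ℝ) :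
    Measurable fun b : Fin m → E => minNormSol z b := by
  have h (i : Fin m) : Measurable fun b : Fin m → E => ((gram ℝ b)⁻¹ *ᵥ z) i := by
    simp only [Matrix.inv_def, Ring.inverse_eq_inv', smul_mulVec, Pi.smul_apply, smul_eq_mul]
    refine (continuous_gram.matrix_det.measurable.inv).mul (Continuous.measurable ?_)
    exact (continuous_apply i).comp (continuous_gram.matrix_adjugate.matrix_mulVec
      continuous_const)
  unfold minNormSol
  exact Finset.measurable_sum _ fun i _ => (h i).smul (measurable_pi_apply i)

lemma map_orthogonalProjectionOnto_stdGaussian (S : Submodule ℝ E) :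
    (stdGaussian E).map S.orthogonalProjectionOnto = stdGaussian S := by
  apply Measure.ext_of_charFun
  ext t
  rw [charFun_apply, integral_map (by fun_prop) (by fun_prop)]
  have h (x : E) : ⟪S.orthogonalProjectionOnto x, t⟫ = ⟪x, (t : E)⟫ :=
    Submodule.inner_orthogonalProjectionOnto_eq_of_mem_right t x
  simp_rw [h]
  rw [← charFun_apply, charFun_stdGaussian, charFun_stdGaussian, Submodule.coe_norm]

lemma measurePreserving_finCons {α : Type*} [MeasurableSpace α] (μ : Measure α) [SigmaFinite μ]
    (m : ℕ) : MeasurePreserving (fun p : (Fin m → α) × α => (Fin.cons p.2 p.1 : Fin (m + 1) → α))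
      ((Measure.pi fun _ : Fin m => μ).prod μ) (Measure.pi fun _ : Fin (m + 1) => μ) := by
  have h := (measurePreserving_piFinSuccAbove (fun _ : Fin (m + 1) => μ) 0).symm
  convert! h.comp Measure.measurePreserving_swap using 1
  ext p i
  simp [MeasurableEquiv.piFinSuccAbove, Fin.insertNthEquiv]

lemma ae_linearIndependent_pi_stdGaussian {m : ℕ} (hm : m ≤ Module.finrank ℝ E) :
    ∀ᵐ b ∂Measure.pi (fun _ : Fin m => stdGaussian E), LinearIndependent ℝ b := by
  have hmeas (k : ℕ) : MeasurableSet {b : Fin k → E | LinearIndependent ℝ b} := by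
    simp_rw [← det_gram_ne_zero_iff_linearIndependent (𝕜 := ℝ)]
    exact (measurableSet_eq_fun continuous_gram.matrix_det.measurable measurable_const).compl
  induction m with
  | zero => exact Filter.Eventually.of_forall fun b => linearIndependent_empty_type
  | succ m ih =>
    have hmp := measurePreserving_finCons (stdGaussian E) m
    rw [← hmp.map_eq, ae_map_iff hmp.measurable.aemeasurable (hmeas _),
      Measure.ae_prod_iff_ae_ae (p := fun p : (Fin m → E) × E =>
        LinearIndependent ℝ (Fin.cons p.2 p.1 : Fin (m + 1) → E)) (hmp.measurable (hmeas _))]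
    filter_upwards [ih (by lia)] with b hb
    have hspan : Submodule.span ℝ (Set.range b) ≠ ⊤ := by
      intro h
      have := finrank_span_eq_card hb
      rw [h, finrank_top, Fintype.card_fin] at this
      lia
    have h0 := Measure.addHaar_submodule volume _ hspan
    filter_upwards [stdGaussian_absolutelyContinuous.ae_le (compl_mem_ae_iff.2 h0)] with g hg
    exact linearIndependent_finCons.2 ⟨hb, hg⟩

lemma integral_norm_minNormSol [Nontrivial E] {m : ℕ} (hm : m + 1 ≤ Module.finrank ℝ E) {n : ℕ}
    (hn : n = Module.finrank ℝ E - m) {c : ℝ} (hc : 0 < c) {h : ℝ → ℝ} (hh : Measurable h)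
    (hbd : ∀ r, ‖h r‖ ≤ 1) :
    ∫ b, h ‖minNormSol (Pi.single 0 c) b‖ ∂Measure.pi (fun _ : Fin (m + 1) => stdGaussian E)
      = ∫ x : E, inverseChiPDF n (Module.finrank ℝ E) c ‖x‖ * h ‖x‖ := by
  have hmp := measurePreserving_finCons (stdGaussian E) m
  have hF : Measurable fun b : Fin (m + 1) → E => h ‖minNormSol (Pi.single 0 c) b‖ :=
    hh.comp (measurable_minNormSol _).norm
  rw [← hmp.map_eq, integral_map hmp.measurable.aemeasurable hF.aestronglyMeasurable,
    integral_prod (fun p : (Fin m → E) × E =>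
      h ‖minNormSol (Pi.single 0 c) (Fin.cons p.2 p.1 : Fin (m + 1) → E)‖)
      (Integrable.of_bound (C := 1) (hF.comp hmp.measurable).aestronglyMeasurable
        (Filter.Eventually.of_forall fun _ => hbd _))]
  have key : ∀ᵐ b ∂Measure.pi (fun _ : Fin m => stdGaussian E),
      ∫ g, h ‖minNormSol (Pi.single 0 c) (Fin.cons g b : Fin (m + 1) → E)‖ ∂stdGaussian E
        = ∫ x : E, inverseChiPDF n (Module.finrank ℝ E) c ‖x‖ * h ‖x‖ := by
    filter_upwards [ae_linearIndependent_pi_stdGaussian (E := E) (by lia : m ≤ _),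
      Measure.ae_ae_of_ae_prod
        (hmp.quasiMeasurePreserving.ae (ae_linearIndependent_pi_stdGaussian hm))] with b hb hgb
    set S := (Submodule.span ℝ (Set.range b))ᗮ with hS
    have hfin : Module.finrank ℝ S = n := by
      have h1 := (Submodule.span ℝ (Set.range b)).finrank_add_finrank_orthogonal
      rw [finrank_span_eq_card hb, Fintype.card_fin, ← hS] at h1
      lia
    have : Nontrivial S := Module.nontrivial_of_finrank_pos (R := ℝ) (by lia)
    have h1 : ∀ᵐ g ∂stdGaussian E,
        h ‖minNormSol (Pi.single 0 c) (Fin.cons g b : Fin (m + 1) → E)‖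
          = h (c / ‖S.orthogonalProjectionOnto g‖) := by
      filter_upwards [hgb] with g hg
      rw [norm_minNormSol_single_cons hc hg]
    have h2 : Measurable fun x : S => h (c / ‖x‖) := by fun_prop
    rw [integral_congr_ae h1, ← hfin, integral_inverseChiPDF hc,
      ← map_orthogonalProjectionOnto_stdGaussian,
      integral_map (by fun_prop) h2.aestronglyMeasurable]
  rw [integral_congr_ae key]
  simp

/-- The law of the minimal norm solution of Gaussian equations with right-hand side `c e₀`. -/
lemma map_minNormSol_single [Nontrivial E] {m : ℕ} (hm : m + 1 ≤ Module.finrank ℝ E) {n : ℕ}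
    (hn : n = Module.finrank ℝ E - m) {c : ℝ} (hc : 0 < c) :
    (Measure.pi fun _ : Fin (m + 1) => stdGaussian E).map (minNormSol (Pi.single 0 c))
      = volume.withDensity fun x =>
        ENNReal.ofReal (inverseChiPDF n (Module.finrank ℝ E) c ‖x‖) := by
  have hnn := inverseChiPDF_nonneg (n := n) (d := Module.finrank ℝ E) (by lia) (by lia) c
  have hone : ∫ x : E, inverseChiPDF n (Module.finrank ℝ E) c ‖x‖ = 1 := by
    have := integral_norm_minNormSol hm hn hc (h := fun _ => 1) measurable_const (by simp)
    simpa using this.symm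
  have hint : Integrable fun x : E => inverseChiPDF n (Module.finrank ℝ E) c ‖x‖ :=
    .of_integral_ne_zero (by rw [hone]; exact one_ne_zero)
  have := isFiniteMeasure_withDensity_ofReal hint.2
  have hmeas := measurable_minNormSol (E := E) (Pi.single (0 : Fin (m + 1)) c)
  have := Measure.isProbabilityMeasure_map (μ := Measure.pi fun _ : Fin (m + 1) => stdGaussian E)
    hmeas.aemeasurable
  refine ext_of_map_norm_eq (fun f => ?_) (fun f => ?_) ?_
  · have hpi : (Measure.pi fun _ : Fin (m + 1) => stdGaussian E).map (fun b i => f (b i))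
        = Measure.pi fun _ => stdGaussian E := by
      rw [Measure.pi_map_pi (fun _ => by fun_prop)]
      simp [stdGaussian_map]
    conv_rhs => rw [← hpi, Measure.map_map hmeas (by fun_prop)]
    rw [Measure.map_map (by fun_prop) hmeas]
    congr 1
    ext b
    exact (minNormSol_map _ b f).symm
  · conv_lhs => enter [2, 2, x]; rw [← f.norm_map]
    exact map_withDensity_comp (f.measurePreserving) (f := fun x : E =>
      ENNReal.ofReal (inverseChiPDF n (Module.finrank ℝ E) c ‖x‖)) (by fun_prop)
  · rw [Measure.map_map (by fun_prop) hmeas]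
    ext s hs
    have hs' : MeasurableSet ((fun x : E => ‖x‖) ⁻¹' s) := measurable_norm hs
    rw [← measureReal_eq_measureReal_iff, map_measureReal_apply (by fun_prop) hs,
      map_measureReal_apply (by fun_prop) hs]
    have h1 := integral_norm_minNormSol hm hn hc (h := s.indicator 1)
      (measurable_one.indicator hs) fun r => by
        by_cases hr : r ∈ s <;> simp [hr]
    rw [← integral_indicator_one (hs.preimage (by fun_prop)), ← integral_indicator_one hs',
      integral_withDensity_eq_integral_toReal_smul (by fun_prop) (by simp)]
    simp_rw [ENNReal.toReal_ofReal (hnn _)]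
    exact h1

end GaussianFamily

section Reduction

lemma sum_norm_sum_smul_sq {E : Type*} [NormedAddCommGroup E] [InnerProductSpace ℝ E]
    {ι κ : Type*} [Fintype ι] [Fintype κ] [DecidableEq ι] {V : Matrix ι κ ℝ} (hV : V * Vᵀ = 1)
    (t : ι → E) : ∑ k, ‖∑ i, V i k • t i‖ ^ 2 = ∑ i, ‖t i‖ ^ 2 := by
  have h (i j : ι) : ∑ k, V i k * V j k = if i = j then 1 else 0 := by
    rw [← one_apply, ← hV]; rfl
  simp_rw [← real_inner_self_eq_norm_sq, sum_inner, inner_sum, real_inner_smul_left,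
    real_inner_smul_right]
  rw [Finset.sum_comm]
  refine Finset.sum_congr rfl fun i _ => ?_
  rw [Finset.sum_comm]
  simp_rw [← mul_assoc, ← Finset.sum_mul, h]
  simp

/-- Combining independent standard Gaussian vectors along orthonormal rows yields independent
standard Gaussian vectors. -/
lemma map_sum_smul_pi_stdGaussian {E : Type*} [NormedAddCommGroup E] [InnerProductSpace ℝ E]
    [FiniteDimensional ℝ E] [MeasurableSpace E] [BorelSpace E] {ι κ : Type*} [Fintype ι]
    [Fintype κ] [DecidableEq ι] {V : Matrix ι κ ℝ} (hV : V * Vᵀ = 1) :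
    (Measure.pi fun _ : κ => stdGaussian E).map (fun a i => ∑ k, V i k • a k)
      = Measure.pi fun _ => stdGaussian E := by
  have hmeas : Measurable fun (a : κ → E) i => ∑ k, V i k • a k :=
    measurable_pi_lambda _ fun i => by fun_prop
  have := Measure.isProbabilityMeasure_map (μ := Measure.pi fun _ : κ => stdGaussian E)
    hmeas.aemeasurable
  rw [← charFun_eq_pi_iff]
  intro t
  have h (a : κ → E) : ⟪WithLp.toLp 2 (fun i => ∑ k, V i k • a k), t⟫
      = ⟪WithLp.toLp 2 a, WithLp.toLp 2 fun k => ∑ i, V i k • t i⟫ := by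
    simp only [PiLp.inner_apply, sum_inner, inner_sum, real_inner_smul_left, real_inner_smul_right]
    exact Finset.sum_comm
  rw [charFun_apply, Measure.map_map (by fun_prop) hmeas,
    integral_map ((WithLp.measurable_toLp 2 _).comp hmeas).aemeasurable (by fun_prop)]
  simp only [Function.comp_def, h]
  have h2 := charFun_pi (μ := fun _ : κ => stdGaussian E)
    (WithLp.toLp 2 fun k => ∑ i, V i k • t i)
  rw [charFun_apply, integral_map (by fun_prop) (by fun_prop)] at h2
  rw [h2]
  simp_rw [charFun_stdGaussian, ← Complex.exp_sum, ← Finset.sum_div, Finset.sum_neg_distrib]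
  exact_mod_cast congrArg (fun x : ℝ => Complex.exp (-x / 2)) (sum_norm_sum_smul_sq hV t.ofLp)

lemma exists_orthogonal_mulVec_eq_single {m : ℕ} {z : Fin (m + 1) → ℝ} (hz : z ≠ 0) :
    ∃ R : Matrix (Fin (m + 1)) (Fin (m + 1)) ℝ,
      R * Rᵀ = 1 ∧ R *ᵥ z = Pi.single 0 ‖WithLp.toLp 2 z‖ := by
  have hz' : ‖WithLp.toLp 2 z‖ ≠ 0 := by simpa using hz
  obtain ⟨e, he⟩ := Orthonormal.exists_orthonormalBasis_extension_of_card_eq (𝕜 := ℝ)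
    (E := EuclideanSpace ℝ (Fin (m + 1))) (ι := Fin (m + 1)) (by simp)
    (v := fun _ => ‖WithLp.toLp 2 z‖⁻¹ • WithLp.toLp 2 z) (s := {0})
    ⟨fun i => by simp [norm_smul, hz'], fun i j hij => (hij (Subsingleton.elim i j)).elim⟩
  have hR (i : Fin (m + 1)) (y : EuclideanSpace ℝ (Fin (m + 1))) :
      ∑ j, e i j * y j = ⟪e i, y⟫ := by
    simp [PiLp.inner_apply, mul_comm]
  refine ⟨of fun i j => e i j, ?_, ?_⟩
  · ext i j
    rw [mul_apply, one_apply]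
    exact (hR i (e j)).trans (e.inner_eq_ite i j)
  · ext i
    have h0 : WithLp.toLp 2 z = ‖WithLp.toLp 2 z‖ • e 0 := by
      rw [he 0 rfl, smul_inv_smul₀ hz']
    refine (hR i (WithLp.toLp 2 z)).trans ?_
    rw [h0, real_inner_smul_right, e.inner_eq_ite, norm_smul, e.norm_eq_one]
    by_cases hi : i = 0 <;> simp [hi]

lemma gram_toLp {m d : ℕ} (B : Matrix (Fin m) (Fin d) ℝ) :
    gram ℝ (fun i => WithLp.toLp 2 (B i)) = B * Bᵀ := by
  ext i j
  simp [gram_apply, PiLp.inner_apply, mul_apply, mul_comm]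

lemma minNormSol_toLp {m d : ℕ} (z : Fin m → ℝ) (B : Matrix (Fin m) (Fin d) ℝ) :
    minNormSol z (fun i => WithLp.toLp 2 (B i)) = WithLp.toLp 2 ((Bᵀ * (B * Bᵀ)⁻¹) *ᵥ z) := by
  ext j
  rw [minNormSol, gram_toLp, ← mulVec_mulVec]
  simp [mulVec, dotProduct, mul_comm]

lemma mulVec_pseudoInverse_transpose_mul {m d : ℕ} {R : Matrix (Fin m) (Fin m) ℝ}
    (hR : R * Rᵀ = 1) (B : Matrix (Fin m) (Fin d) ℝ) (z : Fin m → ℝ) :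
    (Bᵀ * (B * Bᵀ)⁻¹) *ᵥ z = ((R * B)ᵀ * ((R * B) * (R * B)ᵀ)⁻¹) *ᵥ (R *ᵥ z) := by
  have hR' : Rᵀ * R = 1 := mul_eq_one_comm.1 hR
  have h1 : R⁻¹ = Rᵀ := inv_eq_right_inv hR
  have h2 : Rᵀ⁻¹ = R := inv_eq_right_inv hR'
  have h : (R * B) * (R * B)ᵀ = R * (B * Bᵀ) * Rᵀ := by
    simp only [transpose_mul, Matrix.mul_assoc]
  rw [h, Matrix.mul_inv_rev, Matrix.mul_inv_rev, h1, h2, transpose_mul, mulVec_mulVec]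
  congr 1
  calc Bᵀ * (B * Bᵀ)⁻¹ = Bᵀ * ((Rᵀ * R) * (B * Bᵀ)⁻¹ * (Rᵀ * R)) := by simp [hR']
    _ = _ := by simp only [Matrix.mul_assoc]

lemma map_toLp_gaussMatrix (D d : ℕ) :
    (gaussMatrix D d).map (fun A i => WithLp.toLp 2 (A i))
      = Measure.pi fun _ : Fin D => stdGaussian (EuclideanSpace ℝ (Fin d)) := by
  rw [gaussMatrix, Measure.pi_map_pi (fun _ => by fun_prop), map_pi_eq_stdGaussian]

end Reduction

theorem stmt7 (D d de : ℕ) (hD : 0 < D) (hd : 0 < d) (hde : 0 < de)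
    (h1 : de ≤ d) (h2 : d ≤ D) (n : ℕ) (hn : n = d - de + 1)
    (U : Matrix (Fin D) (Fin de) ℝ) (hU : U.transpose * U = 1)
    (zstar : Fin de → ℝ) (hz : zstar ≠ 0)
    (y2 : (Fin D → Fin d → ℝ) → (Fin d → ℝ))
    (hy2 : ∀ A : Fin D → Fin d → ℝ,
      IsUnit ((U.transpose * Matrix.of A) * (U.transpose * Matrix.of A).transpose) →
      y2 A = ((U.transpose * Matrix.of A).transpose *
        ((U.transpose * Matrix.of A) * (U.transpose * Matrix.of A).transpose)⁻¹).mulVec zstar) :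
    Measure.map y2 (gaussMatrix D d)
      = volume.withDensity (fun y : Fin d → ℝ => ENNReal.ofReal (
          Real.pi ^ (-(d : ℝ) / 2) *
          (Real.Gamma ((d : ℝ) / 2) / Real.Gamma ((n : ℝ) / 2)) *
          (Real.sqrt (∑ i, (U.mulVec zstar) i ^ 2) / Real.sqrt 2) ^ n *
          (∑ i, y i ^ 2) ^ (-(((n : ℝ) + (d : ℝ)) / 2)) *
          Real.exp (-(∑ i, (U.mulVec zstar) i ^ 2) / (2 * ∑ i, y i ^ 2)))) := by
  obtain ⟨m, rfl⟩ : ∃ m, de = m + 1 := ⟨de - 1, by lia⟩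
  obtain ⟨R, hR, hRz⟩ := exists_orthogonal_mulVec_eq_single hz
  set c := ‖WithLp.toLp 2 zstar‖ with hc_def
  have hc : 0 < c := norm_pos_iff.2 (by simpa using hz)
  have : Nonempty (Fin d) := ⟨⟨0, hd⟩⟩
  have hc2 : ∑ i, (U *ᵥ zstar) i ^ 2 = c ^ 2 := by
    have h : (U *ᵥ zstar) ⬝ᵥ (U *ᵥ zstar) = zstar ⬝ᵥ zstar := by
      rw [dotProduct_mulVec, vecMul_mulVec, hU, vecMul_one]
    simpa [dotProduct, ← sq, hc_def, EuclideanSpace.real_norm_sq_eq] using h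
  have hV : (R * Uᵀ) * (R * Uᵀ)ᵀ = 1 := by
    rw [transpose_mul, transpose_transpose, Matrix.mul_assoc, ← Matrix.mul_assoc Uᵀ, hU,
      Matrix.one_mul, hR]
  set b : (Fin D → Fin d → ℝ) → Fin (m + 1) → EuclideanSpace ℝ (Fin d) :=
    fun A i => WithLp.toLp 2 ((R * Uᵀ * of A) i) with hb_def
  have hb_eq : b = (fun a i => ∑ k, (R * Uᵀ) i k • a k) ∘ fun A i => WithLp.toLp 2 (A i) := by
    ext A i j
    simp [hb_def, mul_apply (M := R * Uᵀ)]
  have hb : Measurable b := by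
    rw [hb_eq]; fun_prop
  have hlaw : (gaussMatrix D d).map b
      = Measure.pi fun _ => stdGaussian (EuclideanSpace ℝ (Fin d)) := by
    rw [hb_eq, ← Measure.map_map (by fun_prop) (by fun_prop), map_toLp_gaussMatrix,
      map_sum_smul_pi_stdGaussian hV]
  have hli : ∀ᵐ A ∂gaussMatrix D d, LinearIndependent ℝ (b A) := by
    refine ae_of_ae_map (p := fun b => LinearIndependent ℝ b) hb.aemeasurable ?_
    rw [hlaw]
    exact ae_linearIndependent_pi_stdGaussian (by simpa using h1)
  have hy : y2 =ᵐ[gaussMatrix D d]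
      WithLp.ofLp ∘ minNormSol (Pi.single 0 c) ∘ b := by
    filter_upwards [hli] with A hA
    have hdet := det_gram_ne_zero_iff_linearIndependent.2 hA
    rw [hb_def, gram_toLp, Matrix.mul_assoc R, transpose_mul, Matrix.mul_assoc, det_mul,
      ← Matrix.mul_assoc, det_mul] at hdet
    rw [hy2 A ((isUnit_iff_isUnit_det _).2
      (isUnit_iff_ne_zero.2 (left_ne_zero_of_mul (right_ne_zero_of_mul hdet)))),
      mulVec_pseudoInverse_transpose_mul hR, hRz, ← Matrix.mul_assoc]
    exact (congrArg WithLp.ofLp (minNormSol_toLp _ _)).symm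
  rw [Measure.map_congr hy, ← Measure.map_map (by fun_prop)
      ((measurable_minNormSol _).comp hb), ← Measure.map_map (measurable_minNormSol _) hb, hlaw,
    map_minNormSol_single (n := n) (by simpa using h1) (by simp; lia) hc]
  have hdens := map_withDensity_comp (PiLp.volume_preserving_ofLp (Fin d))
    (f := fun y : Fin d → ℝ => ENNReal.ofReal (inverseChiPDF n d c ‖WithLp.toLp 2 y‖))
    (by fun_prop)
  simp only [finrank_euclideanSpace, Fintype.card_fin, WithLp.toLp_ofLp] at hdens ⊢
  rw [hdens]
  simp only [inverseChiPDF, hc2, EuclideanSpace.real_norm_sq_eq]
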